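/- For every correct comparison-based join algorithm (modeled as a ternary decision tree) and every database instance I, the set of comparisons, with their outcomes on I, encountered along the root-to-leaf path followed on I is a certificate that is satisfied by I. Consequently, on every instance I such an algorithm performs at least |C| comparisons, where C is a minimum-size certificate for I. -/

import Mathlib

/-! Core model of indexed natural-join queries, arguments and certificates. -/

/-- `x` is a valid index tuple for a search tree with fanout function `f` and depth
(arity) `ar`: it is nonempty, of length at most `ar`, and every coordinate is `1`-based
and within the fanout of the corresponding prefix. -/
def ValidIdx (f : List ℕ → ℕ) (ar : ℕ) (x : List ℕ) : Prop :=
  x ≠ [] ∧ x.length ≤ ar ∧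
    ∀ j : Fin x.length, 1 ≤ x.get j ∧ x.get j ≤ f (x.take j.val)

/-- `v` is a valid valuation (a "database instance") for the search-tree shape `(f, ar)`:
the values assigned to the children of a common prefix strictly increase. -/
def IsInstVal (f : List ℕ → ℕ) (ar : ℕ) (v : List ℕ → ℕ) : Prop :=
  ∀ (x : List ℕ) (i : ℕ), ValidIdx f ar (x ++ [i]) → ValidIdx f ar (x ++ [i + 1]) →
    v (x ++ [i]) < v (x ++ [i + 1])

/-- A symbolic comparison `R[x] θ S[y]` between two variables, `θ ∈ {<, =, >}`. -/
structure Comp (ι : Type) where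
  R : ι
  x : List ℕ
  S : ι
  y : List ℕ
  o : Ordering
deriving DecidableEq

variable {n : ℕ} {ι : Type}

/-- The list of attributes of relation `R`, in the order of the GAO `ρ`. -/
def attrList (attrs : ι → Finset (Fin n)) (ρ : List (Fin n)) (R : ι) : List (Fin n) :=
  ρ.filter (fun a => decide (a ∈ attrs R))

/-- The arity of relation `R`. -/
def arity (attrs : ι → Finset (Fin n)) (ρ : List (Fin n)) (R : ι) : ℕ :=
  (attrList attrs ρ R).length

/-- Well-formedness of a comparison: both index tuples are valid, and the two variables
are on the same attribute. -/
def CompWF (attrs : ι → Finset (Fin n)) (ρ : List (Fin n)) (f : ι → List ℕ → ℕ)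
    (c : Comp ι) : Prop :=
  ValidIdx (f c.R) (arity attrs ρ c.R) c.x ∧
  ValidIdx (f c.S) (arity attrs ρ c.S) c.y ∧
  (attrList attrs ρ c.R)[c.x.length - 1]? = (attrList attrs ρ c.S)[c.y.length - 1]?

/-- The valuation `v` satisfies the comparison `c`. -/
def SatComp (v : ι → List ℕ → ℕ) (c : Comp ι) : Prop :=
  compare (v c.R c.x) (v c.S c.y) = c.o

/-- `W` is a witness: one full valid index tuple per relation, all contributing to a common
output tuple `t`. -/
def IsWitness (attrs : ι → Finset (Fin n)) (ρ : List (Fin n)) (f : ι → List ℕ → ℕ)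
    (v : ι → List ℕ → ℕ) (W : ι → List ℕ) : Prop :=
  (∀ R, ValidIdx (f R) (arity attrs ρ R) (W R) ∧ (W R).length = arity attrs ρ R) ∧
  ∃ t : Fin n → ℕ, ∀ (R : ι) (j : ℕ) (a : Fin n),
    (attrList attrs ρ R)[j]? = some a → v R ((W R).take (j + 1)) = t a

/-- `A` is a certificate for the shape `f`: all its comparisons are well-formed, and any two
valuations (database instances with this index structure) satisfying all comparisons of `A`
have exactly the same witnesses. -/
def IsCert (attrs : ι → Finset (Fin n)) (ρ : List (Fin n)) (f : ι → List ℕ → ℕ)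
    (A : Finset (Comp ι)) : Prop :=
  (∀ c ∈ A, CompWF attrs ρ f c) ∧
  ∀ v v' : ι → List ℕ → ℕ,
    (∀ R, IsInstVal (f R) (arity attrs ρ R) (v R)) →
    (∀ R, IsInstVal (f R) (arity attrs ρ R) (v' R)) →
    (∀ c ∈ A, SatComp v c) → (∀ c ∈ A, SatComp v' c) →
    ∀ W, IsWitness attrs ρ f v W ↔ IsWitness attrs ρ f v' W

/-! The search tree (trie) derived from raw relational data. -/

/-- The `k`-th smallest element of a finite set of naturals (`1`-based). -/
def nthVal (s : Finset ℕ) (k : ℕ) : ℕ := (s.sort (· ≤ ·)).getD (k - 1) 0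

/-- The list of values along the path of index tuple `x` in the search tree of the data
`D` with attribute list `L`. -/
def dbValList : List ℕ → Finset (Fin n → ℕ) → List (Fin n) → List ℕ
  | [], _, _ => []
  | _ :: _, _, [] => []
  | i :: xs, D, a :: L' =>
    let w := nthVal (D.image (fun t => t a)) i
    w :: dbValList xs (D.filter (fun t => t a = w)) L'

/-- The fanout below index tuple `x` in the search tree of the data `D` with attribute
list `L`. -/
def dbFanout : List ℕ → Finset (Fin n → ℕ) → List (Fin n) → ℕ
  | _, _, [] => 0
  | [], D, a :: _ => (D.image (fun t => t a)).card
  | i :: xs, D, a :: L' =>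
    let w := nthVal (D.image (fun t => t a)) i
    dbFanout xs (D.filter (fun t => t a = w)) L'

/-- The index structure (shape) of the database `DB`, indexed consistently with the GAO
`ρ`. -/
def dbShape (attrs : ι → Finset (Fin n)) (ρ : List (Fin n))
    (DB : ι → Finset (Fin n → ℕ)) : ι → List ℕ → ℕ :=
  fun R x => dbFanout x (DB R) (attrList attrs ρ R)

/-- The value of the variable `R[x]` in the search trees of the database `DB`, indexed
consistently with the GAO `ρ`. -/
def dbValue (attrs : ι → Finset (Fin n)) (ρ : List (Fin n))
    (DB : ι → Finset (Fin n → ℕ)) : ι → List ℕ → ℕ :=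
  fun R x => (dbValList x (DB R) (attrList attrs ρ R)).getD (x.length - 1) 0

/-- A comparison-based join algorithm: a finite rooted ternary decision tree.  Each internal
node compares two variables `R[x]`, `S[y]` and branches on the outcome `<, =, >`; each leaf
is labeled with a set of witnesses. -/
inductive DTree (ι : Type) where
  | leaf (ws : Set (ι → List ℕ))
  | node (R : ι) (x : List ℕ) (S : ι) (y : List ℕ) (lt eq gt : DTree ι)

/-- Well-formedness of a decision tree: every internal node compares two valid variables on
the same attribute. -/
def DTree.WF (attrs : ι → Finset (Fin n)) (ρ : List (Fin n)) (f : ι → List ℕ → ℕ) :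
    DTree ι → Prop
  | .leaf _ => True
  | .node R x S y l e g =>
      ValidIdx (f R) (arity attrs ρ R) x ∧ ValidIdx (f S) (arity attrs ρ S) y ∧
      (attrList attrs ρ R)[x.length - 1]? = (attrList attrs ρ S)[y.length - 1]? ∧
      DTree.WF attrs ρ f l ∧ DTree.WF attrs ρ f e ∧ DTree.WF attrs ρ f g

/-- The comparisons, with their outcomes, encountered along the root-to-leaf path followed
on the instance `v`. -/
def DTree.path (v : ι → List ℕ → ℕ) : DTree ι → List (Comp ι)
  | .leaf _ => []
  | .node R x S y l e g =>
    match compare (v R x) (v S y) with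
    | .lt => ⟨R, x, S, y, Ordering.lt⟩ :: DTree.path v l
    | .eq => ⟨R, x, S, y, Ordering.eq⟩ :: DTree.path v e
    | .gt => ⟨R, x, S, y, Ordering.gt⟩ :: DTree.path v g

/-- The set of witnesses output by the tree on the instance `v` (the label of the leaf
reached). -/
def DTree.output (v : ι → List ℕ → ℕ) : DTree ι → Set (ι → List ℕ)
  | .leaf ws => ws
  | .node R x S y l e g =>
    match compare (v R x) (v S y) with
    | .lt => DTree.output v l
    | .eq => DTree.output v e
    | .gt => DTree.output v g

/-- Correctness of a decision tree: on every database instance with the given index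
structure, the leaf reached is labeled with exactly the set of witnesses. -/
def DTree.Correct (attrs : ι → Finset (Fin n)) (ρ : List (Fin n)) (f : ι → List ℕ → ℕ)
    (T : DTree ι) : Prop :=
  ∀ v : ι → List ℕ → ℕ, (∀ R, IsInstVal (f R) (arity attrs ρ R) (v R)) →
    DTree.output v T = {W | IsWitness attrs ρ f v W}

/-- Along the path of `v`, every other valuation satisfying the path comparisons gets the
same output. -/
theorem DTree.output_eq_of_sat_path {v w : ι → List ℕ → ℕ} (T : DTree ι)
    (h : ∀ c ∈ DTree.path v T, SatComp w c) : DTree.output w T = DTree.output v T := by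
  induction T with
  | leaf ws => rfl
  | node R x S y l e g ihl ihe ihg =>
    cases hc : compare (v R x) (v S y) <;>
      simp only [DTree.path, hc, List.forall_mem_cons] at h <;>
      obtain ⟨h1, h2⟩ := h <;>
      have h1' : compare (w R x) (w S y) = _ := h1 <;>
      simp only [DTree.output, hc, h1']
    exacts [ihl h2, ihe h2, ihg h2]

/-- Every valuation satisfies the comparisons on its own path. -/
theorem DTree.sat_path (v : ι → List ℕ → ℕ) (T : DTree ι) :
    ∀ c ∈ DTree.path v T, SatComp v c := by
  induction T with
  | leaf ws => simp [DTree.path]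
  | node R x S y l e g ihl ihe ihg =>
    cases hc : compare (v R x) (v S y) <;>
      simp only [DTree.path, hc, List.forall_mem_cons]
    exacts [⟨hc, ihl⟩, ⟨hc, ihe⟩, ⟨hc, ihg⟩]

/-- The comparisons on a path of a well-formed tree are well-formed. -/
theorem DTree.WF.compWF_path {attrs : ι → Finset (Fin n)} {ρ : List (Fin n)}
    {f : ι → List ℕ → ℕ} (v : ι → List ℕ → ℕ) (T : DTree ι) (hT : DTree.WF attrs ρ f T) :
    ∀ c ∈ DTree.path v T, CompWF attrs ρ f c := by
  induction T with
  | leaf ws => simp [DTree.path]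
  | node R x S y l e g ihl ihe ihg =>
    obtain ⟨hx, hy, hxy, hl, he, hg⟩ := hT
    cases hc : compare (v R x) (v S y) <;>
      simp only [DTree.path, hc, List.forall_mem_cons]
    exacts [⟨⟨hx, hy, hxy⟩, ihl hl⟩, ⟨⟨hx, hy, hxy⟩, ihe he⟩, ⟨⟨hx, hy, hxy⟩, ihg hg⟩]

/-- For every correct comparison-based join algorithm and every database instance `v`, the
set of comparisons (with their outcomes) made along the root-to-leaf path followed on `v`
is a certificate satisfied by `v`; consequently the algorithm makes at least `|C|`
comparisons on `v`, where `C` is any minimum-size certificate for `v`. -/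
theorem stmt_5 {n : ℕ} {ι : Type} [DecidableEq ι]
    (attrs : ι → Finset (Fin n)) (ρ : List (Fin n)) (hnd : ρ.Nodup) (hall : ∀ a : Fin n, a ∈ ρ)
    (f : ι → List ℕ → ℕ) (T : DTree ι)
    (hwf : DTree.WF attrs ρ f T) (hcor : DTree.Correct attrs ρ f T)
    (v : ι → List ℕ → ℕ) (hv : ∀ R, IsInstVal (f R) (arity attrs ρ R) (v R)) :
    (IsCert attrs ρ f (DTree.path v T).toFinset ∧
      ∀ c ∈ (DTree.path v T).toFinset, SatComp v c) ∧
    (∀ C : Finset (Comp ι),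
      IsCert attrs ρ f C → (∀ c ∈ C, SatComp v c) →
      (∀ C' : Finset (Comp ι), IsCert attrs ρ f C' → (∀ c ∈ C', SatComp v c) →
        C.card ≤ C'.card) →
      C.card ≤ (DTree.path v T).length) := by
  have hcert : IsCert attrs ρ f (DTree.path v T).toFinset := by
    refine ⟨fun c hc => hwf.compWF_path v T c (List.mem_toFinset.mp hc), ?_⟩
    intro w w' hw hw' hsat hsat' W
    have h := DTree.output_eq_of_sat_path T fun c hc => hsat c (List.mem_toFinset.mpr hc)
    have h' := DTree.output_eq_of_sat_path T fun c hc => hsat' c (List.mem_toFinset.mpr hc)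
    have key : {W | IsWitness attrs ρ f w W} = {W | IsWitness attrs ρ f w' W} := by
      rw [← hcor w hw, ← hcor w' hw', h, h']
    exact Set.ext_iff.mp key W
  have hsat : ∀ c ∈ (DTree.path v T).toFinset, SatComp v c := fun c hc =>
    DTree.sat_path v T c (List.mem_toFinset.mp hc)
  exact ⟨⟨hcert, hsat⟩, fun C _ _ hmin =>
    (hmin _ hcert hsat).trans (List.toFinset_card_le _)⟩
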